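/- arXiv:0903.1554 — 4 statements merged into one kernel-verified Lean document; each statement's English description precedes it below -/
import Mathlib

section
/- Let K be a field and V a K-vector space. With the operations defined on T_↘(V), the following five identities hold for all u, v, w ∈ T_↘(V): (u·v) ↘ w = u ↘ (v ↘ w); (u·v)·w = u·(v·w); (u ↘ v)·w = u ↘ (v·w); (u ↘ v) ↘ w = 0; and u·(v ↘ w) = 0. (That is, T_↘(V) is an algebra over the Koszul dual operad P_↘^!.) -/
open scoped TensorProduct DirectSum

noncomputable section

variable (K : Type*) [Field K] (V : Type*) [AddCommGroup V] [Module K V]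

/-- `n`-th tensor power of `V`. -/
abbrev TP (n : ℕ) : Type _ := ⨂[K]^n V

/-- Cast between tensor powers along an equality of exponents. -/
def castE {a b : ℕ} (h : a = b) : TP K V a ≃ₗ[K] TP K V b :=
  PiTensorProduct.reindex K (fun _ => V) (finCongr h)

/-- Concatenation of tensor powers. -/
def mulE (a b : ℕ) : (TP K V a ⊗[K] TP K V b) ≃ₗ[K] TP K V (a + b) :=
  (PiTensorProduct.tmulEquiv K V).trans
    (PiTensorProduct.reindex K (fun _ => V) finSumFinEquiv)

/-- `V^{⊗1} ≅ V`. -/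
def oneE : TP K V 1 ≃ₗ[K] V := PiTensorProduct.subsingletonEquiv (0 : Fin 1)

/-- The space `T(V) = ⊕_{n ≥ 1} ⊕_{k=1}^{n} V^{⊗ n}`; the summand indexed by
`(a, b) : ℕ × ℕ` is the copy of `V^{⊗ (a+1+b)}` whose point (resp. mark count) is at
(1-indexed) position `a + 1`, i.e. `a` letters before the pointed one, `b` after. -/
abbrev TT : Type _ := ⨁ (p : ℕ × ℕ), TP K V (p.1 + 1 + p.2)

/-- Assemble a bilinear map on `TT` from componentwise bilinear maps. -/
def liftBil
    (comp : ∀ i j : ℕ × ℕ,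
      TP K V (i.1 + 1 + i.2) →ₗ[K] TP K V (j.1 + 1 + j.2) →ₗ[K] TT K V) :
    TT K V →ₗ[K] TT K V →ₗ[K] TT K V :=
  DirectSum.toModule K _ _ fun i =>
    (DirectSum.toModule K _ _ fun j => (comp i j).flip).flip

/-- Concatenation of tensor powers as a bilinear map. -/
def concatB (a b : ℕ) : TP K V a →ₗ[K] TP K V b →ₗ[K] TP K V (a + b) :=
  (TensorProduct.mk K (TP K V a) (TP K V b)).compr₂ (mulE K V a b).toLinearMap

/-- The product `m` of `T_↘(V)` (identical for `T_↗(V)`): `v · w` vanishes unless the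
point of `w` is in position `1` (`j.1 = 0`), in which case the words are concatenated,
keeping the point of `v`. -/
def mComp (i j : ℕ × ℕ) :
    TP K V (i.1 + 1 + i.2) →ₗ[K] TP K V (j.1 + 1 + j.2) →ₗ[K] TT K V :=
  if h : j.1 = 0 then
    (concatB K V _ _).compr₂
      ((DirectSum.lof K (ℕ × ℕ) (fun p => TP K V (p.1 + 1 + p.2)) (i.1, i.2 + 1 + j.2)) ∘ₗ
        (castE K V (show (i.1 + 1 + i.2) + (j.1 + 1 + j.2) = i.1 + 1 + (i.2 + 1 + j.2) by
          omega)).toLinearMap)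
  else 0

/-- The product `↘` of `T_↘(V)`: `v ↘ w` vanishes unless the point of `v` is in position
`1` (`i.1 = 0`), in which case the words are concatenated, keeping the point of `w`. -/
def sComp (i j : ℕ × ℕ) :
    TP K V (i.1 + 1 + i.2) →ₗ[K] TP K V (j.1 + 1 + j.2) →ₗ[K] TT K V :=
  if h : i.1 = 0 then
    (concatB K V _ _).compr₂
      ((DirectSum.lof K (ℕ × ℕ) (fun p => TP K V (p.1 + 1 + p.2)) (i.2 + 1 + j.1, j.2)) ∘ₗ
        (castE K V (show (i.1 + 1 + i.2) + (j.1 + 1 + j.2) = (i.2 + 1 + j.1) + 1 + j.2 by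
          omega)).toLinearMap)
  else 0

/-- The product `m` of `T_↘(V)` on the whole space. -/
def Tmul : TT K V →ₗ[K] TT K V →ₗ[K] TT K V := liftBil K V (mComp K V)

/-- The product `↘` of `T_↘(V)` on the whole space. -/
def Tsea : TT K V →ₗ[K] TT K V →ₗ[K] TT K V := liftBil K V (sComp K V)

/-- The word `l` with `a` letters before the pointed one and `b` letters after it. -/
def pointedWord (a b : ℕ) (l : List V) (h : l.length = a + 1 + b) : TT K V :=
  DirectSum.lof K (ℕ × ℕ) (fun p => TP K V (p.1 + 1 + p.2)) (a, b)
    (PiTensorProduct.tprod K fun i => l.get (i.cast h.symm))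

theorem pointedWord_congr {a b a' b' : ℕ} {l l' : List V} (ha : a = a') (hb : b = b')
    (hl : l = l') (h : l.length = a + 1 + b) (h' : l'.length = a' + 1 + b') :
    pointedWord K V a b l h = pointedWord K V a' b' l' h' := by
  subst ha hb hl
  rfl

theorem TT_induction {P : TT K V → Prop} (hadd : ∀ x y, P x → P y → P (x + y))
    (hsmul : ∀ (c : K) x, P x → P (c • x))
    (hword : ∀ a b l h, P (pointedWord K V a b l h)) (x : TT K V) : P x := by
  have hzero : P 0 := by simpa using hsmul 0 _ (hword 0 0 [0] rfl)
  induction x using DirectSum.induction_on with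
  | zero => exact hzero
  | add x y hx hy => exact hadd x y hx hy
  | of p t =>
    obtain ⟨a, b⟩ := p
    change P (DirectSum.lof K (ℕ × ℕ) (fun p => TP K V (p.1 + 1 + p.2)) (a, b) t)
    induction t using PiTensorProduct.induction_on with
    | smul_tprod c f =>
      rw [map_smul]
      refine hsmul c _ ?_
      convert hword a b (List.ofFn f) (by simp) using 1
      unfold pointedWord
      congr 2
      funext i
      simp
    | add t s ht hs => rw [map_add]; exact hadd _ _ ht hs

theorem castE_concatB_tprod {c m n : ℕ} (l l' : List V) (hl : l.length = m)
    (hl' : l'.length = n) (h : m + n = c) (hc : (l ++ l').length = c) :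
    castE K V h (concatB K V m n (PiTensorProduct.tprod K fun i => l.get (i.cast hl.symm))
      (PiTensorProduct.tprod K fun i => l'.get (i.cast hl'.symm))) =
    PiTensorProduct.tprod K fun i => (l ++ l').get (i.cast hc.symm) := by
  subst hl hl' h
  simp only [castE, concatB, mulE, LinearMap.compr₂_apply, TensorProduct.mk_apply,
    LinearEquiv.coe_coe, LinearEquiv.trans_apply]
  erw [PiTensorProduct.tmulEquiv_apply]
  rw [PiTensorProduct.reindex_tprod, PiTensorProduct.reindex_tprod]
  congr 1
  funext i
  induction i using Fin.addCases <;> simp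

theorem liftBil_lof (comp : ∀ i j : ℕ × ℕ,
      TP K V (i.1 + 1 + i.2) →ₗ[K] TP K V (j.1 + 1 + j.2) →ₗ[K] TT K V) (i j : ℕ × ℕ)
    (x : TP K V (i.1 + 1 + i.2)) (y : TP K V (j.1 + 1 + j.2)) :
    liftBil K V comp (DirectSum.lof K (ℕ × ℕ) (fun p => TP K V (p.1 + 1 + p.2)) i x)
      (DirectSum.lof K (ℕ × ℕ) (fun p => TP K V (p.1 + 1 + p.2)) j y) = comp i j x y := by
  simp [liftBil, DirectSum.toModule_lof]

theorem Tmul_pointedWord (a b c d : ℕ) (l l' : List V) (h : l.length = a + 1 + b)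
    (h' : l'.length = c + 1 + d) :
    Tmul K V (pointedWord K V a b l h) (pointedWord K V c d l' h') =
      if hc : c = 0 then
        pointedWord K V a (b + 1 + d) (l ++ l') (by rw [List.length_append]; omega)
      else 0 := by
  unfold Tmul pointedWord
  rw [liftBil_lof, mComp]
  split_ifs
  · simp only [LinearMap.compr₂_apply, LinearMap.comp_apply, LinearEquiv.coe_coe]
    rw [castE_concatB_tprod K V l l' h h' _ (by rw [List.length_append]; omega)]
  · rfl

theorem Tsea_pointedWord (a b c d : ℕ) (l l' : List V) (h : l.length = a + 1 + b)
    (h' : l'.length = c + 1 + d) :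
    Tsea K V (pointedWord K V a b l h) (pointedWord K V c d l' h') =
      if ha : a = 0 then
        pointedWord K V (b + 1 + c) d (l ++ l') (by rw [List.length_append]; omega)
      else 0 := by
  unfold Tsea pointedWord
  rw [liftBil_lof, sComp]
  split_ifs
  · simp only [LinearMap.compr₂_apply, LinearMap.comp_apply, LinearEquiv.coe_coe]
    rw [castE_concatB_tprod K V l l' h h' _ (by rw [List.length_append]; omega)]
  · rfl

/-- `T_↘(V)`, with the concatenation product `m` and the product `↘`
defined above, satisfies the five defining identities of algebras over the Koszul dual
operad `P_↘^!`, for all `u v w : T_↘(V)`. -/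
theorem Tdown_is_Pdual_algebra (u v w : TT K V) :
    Tsea K V (Tmul K V u v) w = Tsea K V u (Tsea K V v w) ∧
    Tmul K V (Tmul K V u v) w = Tmul K V u (Tmul K V v w) ∧
    Tmul K V (Tsea K V u v) w = Tsea K V u (Tmul K V v w) ∧
    Tsea K V (Tsea K V u v) w = 0 ∧
    Tmul K V u (Tsea K V v w) = 0 := by
  induction u using TT_induction with
  | hadd x y hx hy => simp only [map_add, LinearMap.add_apply, hx, hy, add_zero, and_self]
  | hsmul c x hx => simp only [map_smul, LinearMap.smul_apply, hx, smul_zero, and_self]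
  | hword a b l h =>
  induction v using TT_induction with
  | hadd x y hx hy => simp only [map_add, LinearMap.add_apply, hx, hy, add_zero, and_self]
  | hsmul c x hx => simp only [map_smul, LinearMap.smul_apply, hx, smul_zero, and_self]
  | hword a' b' l' h' =>
  induction w using TT_induction with
  | hadd x y hx hy => simp only [map_add, hx, hy, add_zero, and_self]
  | hsmul c x hx => simp only [map_smul, hx, smul_zero, and_self]
  | hword a'' b'' l'' h'' =>
  refine ⟨?_, ?_, ?_, ?_, ?_⟩ <;> simp only [Tmul_pointedWord, Tsea_pointedWord] <;>
    split_ifs <;>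
    simp only [map_zero, LinearMap.zero_apply, Tmul_pointedWord, Tsea_pointedWord] <;>
    split_ifs <;>
    first
    | rfl
    | omega
    | exact pointedWord_congr K V (by omega) (by omega) (by simp) _ _
end
end

section
/- In the planar forest algebra A^D, the following identities hold for all forests F, G, H ∈ F^D (hence, by bilinearity, for all elements of A^D): (F·G)·H = F·(G·H); (F ↗ G) ↗ H = F ↗ (G ↗ H); and (F ↗ G)·H = F ↗ (G·H). (These are the three defining relations of P_↗-algebras, satisfied by the free P_↗-algebra on the set D.) -/
noncomputable section

/-- A planar rooted tree decorated by `D`: a root decorated by an element of `D` together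
with a (possibly empty) ordered list of planar subtrees. -/
inductive PTree (D : Type) : Type
  | node : D → List (PTree D) → PTree D

/-- A nonempty planar forest decorated by `D`: a nonempty ordered list of `D`-decorated
planar rooted trees, given by its first tree and the list of the remaining ones. -/
structure PForest (D : Type) : Type where
  head : PTree D
  tail : List (PTree D)

namespace PForest

variable {D : Type}

/-- The underlying list of trees of a forest. -/
def toList (F : PForest D) : List (PTree D) := F.head :: F.tail

/-- Concatenation `F · G` of two forests. -/
def concat (F G : PForest D) : PForest D := ⟨F.head, F.tail ++ G.toList⟩

/-- Left grafting on the root: for `G = B_d(t₁ … t_m) G'`,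
`F ↘ G = B_d(F t₁ … t_m) G'`. -/
def graftRoot (F G : PForest D) : PForest D :=
  match G with
  | ⟨.node d ts, G'⟩ => ⟨.node d (F.toList ++ ts), G'⟩

/-- Left grafting of a forest on the leftmost leaf of a tree. -/
def graftLeafT (L : List (PTree D)) : PTree D → PTree D
  | .node d [] => .node d L
  | .node d (h :: hs) => .node d (graftLeafT L h :: hs)

/-- Left grafting on the leftmost leaf: for `G = B_d(H) G'`, `F ↗ G = B_d(F) G'` if `H`
is empty, and `F ↗ G = B_d(F ↗ H) G'` otherwise. -/
def graftLeaf (F G : PForest D) : PForest D := ⟨graftLeafT F.toList G.head, G.tail⟩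

/-- The single-vertex tree `•_d`, as a forest. -/
def vertex (d : D) : PForest D := ⟨.node d [], []⟩

end PForest

variable (K : Type*) [Field K] (D : Type)

/-- The planar forest algebra `A^D`: the vector space with basis the set of nonempty
`D`-decorated planar forests. -/
abbrev FA : Type _ := PForest D →₀ K

/-- The bilinear extension to `A^D` of a binary operation on forests. -/
def bil (op : PForest D → PForest D → PForest D) : FA K D →ₗ[K] FA K D →ₗ[K] FA K D :=
  Finsupp.lsum K fun F =>
    LinearMap.toSpanSingleton K (FA K D →ₗ[K] FA K D)
      (Finsupp.lsum K fun G =>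
        LinearMap.toSpanSingleton K (FA K D) (Finsupp.single (op F G) (1 : K)))
namespace PForest

theorem concat_assoc {D : Type} (F G H : PForest D) :
    (F.concat G).concat H = F.concat (G.concat H) := by
  simp [concat, toList]

theorem graftLeafT_graftLeafT {D : Type} (L : List (PTree D)) (t : PTree D)
    (ts : List (PTree D)) :
    ∀ u : PTree D,
      graftLeafT (graftLeafT L t :: ts) u = graftLeafT L (graftLeafT (t :: ts) u)
  | .node d [] => by simp [graftLeafT]
  | .node d (h :: hs) => by simp [graftLeafT, graftLeafT_graftLeafT L t ts h]

theorem graftLeaf_assoc {D : Type} (F G H : PForest D) :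
    (F.graftLeaf G).graftLeaf H = F.graftLeaf (G.graftLeaf H) := by
  simp [graftLeaf, toList, graftLeafT_graftLeafT]

theorem graftLeaf_concat {D : Type} (F G H : PForest D) :
    (F.graftLeaf G).concat H = F.graftLeaf (G.concat H) :=
  rfl

end PForest

theorem bil_single (op : PForest D → PForest D → PForest D) (F G : PForest D) (a b : K) :
    bil K D op (Finsupp.single F a) (Finsupp.single G b) =
      Finsupp.single (op F G) (a * b) := by
  simp [bil]

/-- An identity `(F ∘₂ G) ∘₁ H = F ∘₃ (G ∘₄ H)` between operations on forests extends to
`A^D` by trilinearity. -/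
theorem bil_bil_of_forall {op₁ op₂ op₃ op₄ : PForest D → PForest D → PForest D}
    (h : ∀ F G H, op₁ (op₂ F G) H = op₃ F (op₄ G H)) (x y z : FA K D) :
    bil K D op₁ (bil K D op₂ x y) z = bil K D op₃ x (bil K D op₄ y z) := by
  induction x using Finsupp.induction_linear with
  | zero => simp
  | add x x' hx hx' => simp [hx, hx']
  | single F a =>
    induction y using Finsupp.induction_linear with
    | zero => simp
    | add y y' hy hy' => simp [hy, hy']
    | single G b =>
      induction z using Finsupp.induction_linear with
      | zero => simp
      | add z z' hz hz' => simp [hz, hz']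
      | single H c => simp only [bil_single, h, mul_assoc]

/-- In the planar forest algebra `A^D`, the three defining relations of
`P_↗`-algebras hold: for all forests `F G H` (and hence, by bilinearity, for all elements
of `A^D`), `(F·G)·H = F·(G·H)`, `(F ↗ G) ↗ H = F ↗ (G ↗ H)` and `(F ↗ G)·H = F ↗ (G·H)`. -/
theorem forest_algebra_Pup_relations [Fintype D] :
    (∀ F G H : PForest D,
      (F.concat G).concat H = F.concat (G.concat H) ∧
      (F.graftLeaf G).graftLeaf H = F.graftLeaf (G.graftLeaf H) ∧
      (F.graftLeaf G).concat H = F.graftLeaf (G.concat H)) ∧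
    (∀ x y z : FA K D,
      bil K D PForest.concat (bil K D PForest.concat x y) z =
        bil K D PForest.concat x (bil K D PForest.concat y z) ∧
      bil K D PForest.graftLeaf (bil K D PForest.graftLeaf x y) z =
        bil K D PForest.graftLeaf x (bil K D PForest.graftLeaf y z) ∧
      bil K D PForest.concat (bil K D PForest.graftLeaf x y) z =
        bil K D PForest.graftLeaf x (bil K D PForest.concat y z)) := by
  exact ⟨fun F G H =>
      ⟨PForest.concat_assoc F G H, PForest.graftLeaf_assoc F G H,
        PForest.graftLeaf_concat F G H⟩,
    fun x y z =>
      ⟨bil_bil_of_forall K D PForest.concat_assoc x y z,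
        bil_bil_of_forall K D PForest.graftLeaf_assoc x y z,
        bil_bil_of_forall K D PForest.graftLeaf_concat x y z⟩⟩
end
end

section
/- Let A be a K-vector space with two bilinear operations (a,b) ↦ ab and (a,b) ↦ a ↘ b, and let d be the map on C_* defined from these operations. Then for all v_1, v_2, v_3 ∈ A: d(d(v̇_1 ⊗ v_2 ⊗ v_3)) = (v_1v_2)v_3 − v_1(v_2v_3), d(d(v_1 ⊗ v̇_2 ⊗ v_3)) = (v_1 ↘ v_2)v_3 − v_1 ↘ (v_2v_3), and d(d(v_1 ⊗ v_2 ⊗ v̇_3)) = (v_1v_2) ↘ v_3 − v_1 ↘ (v_2 ↘ v_3). Consequently d∘d vanishes on C_3 if and only if the three relations (ab)c = a(bc), (a↘b)c = a↘(bc) and (ab)↘c = a↘(b↘c) hold for all a, b, c ∈ A. -/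
open scoped TensorProduct DirectSum

noncomputable section

variable (K : Type*) [Field K] (V : Type*) [AddCommGroup V] [Module K V]

variable (f g : V →ₗ[K] V →ₗ[K] V)

/-- The bilinear map `f` applied to `V^{⊗2}`. -/
def f2 : TP K V 2 →ₗ[K] V :=
  TensorProduct.lift f ∘ₗ
    TensorProduct.map (oneE K V).toLinearMap (oneE K V).toLinearMap ∘ₗ
    (mulE K V 1 1).symm.toLinearMap ∘ₗ (castE K V (show 2 = 1 + 1 by rfl)).toLinearMap

/-- The map `V^{⊗(p+2+q)} → V^{⊗(p+1+q)}` contracting the letters in positions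
`p+1, p+2` (1-indexed) by means of the bilinear operation `f`. -/
def mergeCore (p q : ℕ) : TP K V (p + (2 + q)) →ₗ[K] TP K V (p + (1 + q)) :=
  (mulE K V p (1 + q)).toLinearMap ∘ₗ
    TensorProduct.map LinearMap.id
      ((mulE K V 1 q).toLinearMap ∘ₗ
        TensorProduct.map ((oneE K V).symm.toLinearMap ∘ₗ f2 K V f) LinearMap.id ∘ₗ
        (mulE K V 2 q).symm.toLinearMap) ∘ₗ
    (mulE K V p (2 + q)).symm.toLinearMap

/-- The map `V^{⊗n} → V^{⊗(n-1)}` contracting the letters in positions `p+1, p+2`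
(1-indexed, `0 ≤ p ≤ n-2`) by means of the bilinear operation `f`. -/
def mergeAt (n p : ℕ) (h : p + 2 ≤ n) : TP K V n →ₗ[K] TP K V (n - 1) :=
  (castE K V (show p + (1 + (n - p - 2)) = n - 1 by omega)).toLinearMap ∘ₗ
    mergeCore K V f p (n - p - 2) ∘ₗ
    (castE K V (show n = p + (2 + (n - p - 2)) by omega)).toLinearMap
/-- The component on the summand of index `(a, b)` (word of length `n = a+1+b`, pointed
at 1-indexed position `a+1`) of the differential of the complex computing the homology of
an algebra `(V, f, g)` with products `ab := f a b` and `a ↘ b := g a b`: the alternating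
sum over the `n-1` pairs of adjacent letters of the contractions, the pair
`(v_a, v_{a+1})` (0-indexed), i.e. the pointed letter and its left neighbour, being
contracted by `↘` and all other pairs by the product `f`; the point stays on the merged
letter. -/
def dCompDown (a b : ℕ) : TP K V (a + 1 + b) →ₗ[K] TT K V :=
  ∑ p : Fin (a + 1 + b - 1),
    ((-1 : K) ^ (p : ℕ)) •
      (if hpa : (p : ℕ) < a then
        (DirectSum.lof K (ℕ × ℕ) (fun q => TP K V (q.1 + 1 + q.2)) (a - 1, b)) ∘ₗ
          (castE K V (show a + 1 + b - 1 = (a - 1) + 1 + b by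
            have := p.isLt; omega)).toLinearMap ∘ₗ
          mergeAt K V (if (p : ℕ) + 1 = a then g else f) (a + 1 + b) p
            (by have := p.isLt; omega)
      else
        (DirectSum.lof K (ℕ × ℕ) (fun q => TP K V (q.1 + 1 + q.2)) (a, b - 1)) ∘ₗ
          (castE K V (show a + 1 + b - 1 = a + 1 + (b - 1) by
            have := p.isLt; omega)).toLinearMap ∘ₗ
          mergeAt K V f (a + 1 + b) p (by have := p.isLt; omega))

/-- The differential `d` of the complex `C_*` associated with the algebra `(V, f, g)`
with products `ab := f a b` and `a ↘ b := g a b`. -/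
def dDown : TT K V →ₗ[K] TT K V :=
  DirectSum.toModule K (ℕ × ℕ) (TT K V) fun q => dCompDown K V f g q.1 q.2
/-- The inclusion of `V = C_1` into `C_*` as the summand of index `(0,0)`. -/
def iotaC : V →ₗ[K] TT K V :=
  (DirectSum.lof K (ℕ × ℕ) (fun p => TP K V (p.1 + 1 + p.2)) (0, 0)) ∘ₗ
    (oneE K V).symm.toLinearMap

/-- The summand `C_3` of the complex: the span of the components of index `(a,b)` with
`a + 1 + b = 3`. -/
def C3 : Submodule K (TT K V) :=
  ⨆ (p : ℕ × ℕ) (_ : p.1 + 1 + p.2 = 3),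
    LinearMap.range (DirectSum.lof K (ℕ × ℕ) (fun q => TP K V (q.1 + 1 + q.2)) p)

section

variable {K V}

theorem mulE_symm_tprod (a b : ℕ) (v : Fin (a + b) → V) :
    (mulE K V a b).symm (PiTensorProduct.tprod K v) =
      PiTensorProduct.tprod K (fun i => v (Fin.castAdd b i)) ⊗ₜ[K]
        PiTensorProduct.tprod K (fun i => v (Fin.natAdd a i)) := by
  simp [mulE]

theorem mulE_tprod (a b : ℕ) (v : Fin a → V) (w : Fin b → V) :
    mulE K V a b (PiTensorProduct.tprod K v ⊗ₜ[K] PiTensorProduct.tprod K w) =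
      PiTensorProduct.tprod K (Fin.append v w) := by
  simp only [mulE, LinearEquiv.trans_apply, PiTensorProduct.tmulEquiv_apply,
    PiTensorProduct.reindex_tprod]
  congr 1
  ext i
  refine Fin.addCases (fun j => ?_) (fun j => ?_) i <;> simp

theorem castE_tprod {a b : ℕ} (h : a = b) (v : Fin a → V) :
    castE K V h (PiTensorProduct.tprod K v) =
      PiTensorProduct.tprod K (fun i => v (Fin.cast h.symm i)) := by
  simp [castE]

theorem f2_tprod (v : Fin 2 → V) :
    f2 K V f (PiTensorProduct.tprod K v) = f (v 0) (v 1) := by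
  simp only [f2, LinearMap.comp_apply, LinearEquiv.coe_coe, castE_tprod]
  rw [mulE_symm_tprod]
  simp only [TensorProduct.map_tmul, oneE, LinearEquiv.coe_coe,
    PiTensorProduct.subsingletonEquiv_apply_tprod, TensorProduct.lift.tmul]
  rfl

theorem mergeCore_tprod (p q : ℕ) (v : Fin (p + (2 + q)) → V) :
    mergeCore K V f p q (PiTensorProduct.tprod K v) =
      PiTensorProduct.tprod K (Fin.append (fun i => v (Fin.castAdd (2 + q) i))
        (Fin.append
          (fun _ : Fin 1 => f (v (Fin.natAdd p (Fin.castAdd q 0)))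
            (v (Fin.natAdd p (Fin.castAdd q 1))))
          (fun i => v (Fin.natAdd p (Fin.natAdd 2 i))))) := by
  simp only [mergeCore, LinearMap.comp_apply, LinearEquiv.coe_coe, mulE_symm_tprod,
    TensorProduct.map_tmul, LinearMap.id_apply, f2_tprod, oneE,
    PiTensorProduct.subsingletonEquiv_symm_apply', mulE_tprod]

/-- Contraction of the letters of index `p` and `p + 1` of a word. -/
def contractWord {n : ℕ} (p : ℕ) (h : p + 2 ≤ n) (v : Fin n → V) (m : ℕ) (hm : m + 1 = n) :
    Fin m → V := fun i =>
  if (i : ℕ) < p then v ⟨i, by omega⟩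
  else if (i : ℕ) = p then f (v ⟨p, by omega⟩) (v ⟨p + 1, by omega⟩)
  else v ⟨i + 1, by omega⟩

theorem mergeAt_tprod (n p : ℕ) (h : p + 2 ≤ n) (v : Fin n → V) :
    mergeAt K V f n p h (PiTensorProduct.tprod K v) =
      PiTensorProduct.tprod K (contractWord f p h v (n - 1) (by omega)) := by
  simp only [mergeAt, LinearMap.comp_apply, LinearEquiv.coe_coe, castE_tprod, mergeCore_tprod]
  congr 1
  ext i
  obtain ⟨j, rfl⟩ : ∃ j : Fin (p + (1 + (n - p - 2))), i = Fin.cast (by omega) j :=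
    ⟨Fin.cast (by omega) i, by simp⟩
  simp only [Fin.cast_cast, Fin.cast_eq_self, contractWord, Fin.val_cast]
  induction j using Fin.addCases with
  | left j => simp [Fin.append_left]; rfl
  | right j =>
    induction j using Fin.addCases with
    | left j => simp [Fin.append_left, Fin.append_right]; rfl
    | right j =>
      simp only [Fin.append_right, Fin.val_natAdd]
      rw [if_neg (by omega), if_neg (by omega)]
      congr 1
      ext
      simp
      omega

theorem dDown_lof_tprod (a b : ℕ) (v : Fin (a + 1 + b) → V) :
    dDown K V f g (DirectSum.lof K (ℕ × ℕ) (fun q => TP K V (q.1 + 1 + q.2)) (a, b)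
        (PiTensorProduct.tprod K v)) =
      ∑ p : Fin (a + 1 + b - 1), ((-1 : K) ^ (p : ℕ)) •
        if hpa : (p : ℕ) < a then
          DirectSum.lof K (ℕ × ℕ) (fun q => TP K V (q.1 + 1 + q.2)) (a - 1, b)
            (PiTensorProduct.tprod K (contractWord (if (p : ℕ) + 1 = a then g else f) p
              (by omega) v (a - 1 + 1 + b) (by omega)))
        else
          DirectSum.lof K (ℕ × ℕ) (fun q => TP K V (q.1 + 1 + q.2)) (a, b - 1)
            (PiTensorProduct.tprod K (contractWord f p
              (by omega) v (a + 1 + (b - 1)) (by omega))) := by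
  rw [dDown, DirectSum.toModule_lof]
  simp only [dCompDown, LinearMap.sum_apply, LinearMap.smul_apply]
  refine Finset.sum_congr rfl fun p _ => ?_
  congr 1
  split_ifs <;>
    simp only [LinearMap.comp_apply, LinearEquiv.coe_coe, mergeAt_tprod, castE_tprod] <;> rfl

theorem iotaC_injective : Function.Injective (iotaC K V) :=
  (DirectSum.of_injective (β := fun q : ℕ × ℕ => TP K V (q.1 + 1 + q.2)) (0, 0)).comp
    (oneE K V).symm.injective

theorem lof_zero_zero_tprod (v : Fin 1 → V) :
    DirectSum.lof K (ℕ × ℕ) (fun q => TP K V (q.1 + 1 + q.2)) (0, 0)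
      (PiTensorProduct.tprod K v) = iotaC K V (v 0) := by
  simp only [iotaC, LinearMap.comp_apply, LinearEquiv.coe_coe, oneE,
    PiTensorProduct.subsingletonEquiv_symm_apply']
  congr 2
  ext i
  rw [Subsingleton.elim i 0]

theorem dDown_lof_zero_one_tprod (v : Fin 2 → V) :
    dDown K V f g (DirectSum.lof K (ℕ × ℕ) (fun q => TP K V (q.1 + 1 + q.2)) (0, 1)
        (PiTensorProduct.tprod K v)) = iotaC K V (f (v 0) (v 1)) := by
  rw [dDown_lof_tprod]
  refine (Fin.sum_univ_one _).trans ?_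
  refine Eq.trans ?_ (lof_zero_zero_tprod (K := K) ![f (v 0) (v 1)])
  simp only [Fin.val_zero, pow_zero, one_smul, lt_irrefl, dite_false]
  congr 2
  ext i
  fin_cases i
  rfl

theorem dDown_lof_one_zero_tprod (v : Fin 2 → V) :
    dDown K V f g (DirectSum.lof K (ℕ × ℕ) (fun q => TP K V (q.1 + 1 + q.2)) (1, 0)
        (PiTensorProduct.tprod K v)) = iotaC K V (g (v 0) (v 1)) := by
  rw [dDown_lof_tprod]
  refine (Fin.sum_univ_one _).trans ?_
  refine Eq.trans ?_ (lof_zero_zero_tprod (K := K) ![g (v 0) (v 1)])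
  simp only [Fin.val_zero, pow_zero, one_smul, zero_add, zero_lt_one, if_true,
    dite_true]
  congr 2
  ext i
  fin_cases i
  rfl

theorem dDown_dDown_lof_zero_two_tprod (v : Fin 3 → V) :
    dDown K V f g (dDown K V f g
      (DirectSum.lof K (ℕ × ℕ) (fun q => TP K V (q.1 + 1 + q.2)) (0, 2)
        (PiTensorProduct.tprod K v))) =
      iotaC K V (f (f (v 0) (v 1)) (v 2) - f (v 0) (f (v 1) (v 2))) := by
  rw [dDown_lof_tprod]
  refine (congrArg _ (Fin.sum_univ_two _)).trans ?_
  rw [map_add, map_smul, map_smul, dif_neg (by simp), dif_neg (by simp)]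
  refine (congrArg₂ (fun x y => _ • x + _ • y) (dDown_lof_zero_one_tprod f g _)
    (dDown_lof_zero_one_tprod f g _)).trans ?_
  simp only [← map_smul, ← map_add]
  simp [contractWord, sub_eq_add_neg]

theorem dDown_dDown_lof_one_one_tprod (v : Fin 3 → V) :
    dDown K V f g (dDown K V f g
      (DirectSum.lof K (ℕ × ℕ) (fun q => TP K V (q.1 + 1 + q.2)) (1, 1)
        (PiTensorProduct.tprod K v))) =
      iotaC K V (f (g (v 0) (v 1)) (v 2) - g (v 0) (f (v 1) (v 2))) := by
  rw [dDown_lof_tprod]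
  refine (congrArg _ (Fin.sum_univ_two _)).trans ?_
  rw [map_add, map_smul, map_smul, dif_pos (by simp), dif_neg (by simp)]
  refine (congrArg₂ (fun x y => _ • x + _ • y) (dDown_lof_zero_one_tprod f g _)
    (dDown_lof_one_zero_tprod f g _)).trans ?_
  simp only [← map_smul, ← map_add]
  simp [contractWord, sub_eq_add_neg]

theorem dDown_dDown_lof_two_zero_tprod (v : Fin 3 → V) :
    dDown K V f g (dDown K V f g
      (DirectSum.lof K (ℕ × ℕ) (fun q => TP K V (q.1 + 1 + q.2)) (2, 0)
        (PiTensorProduct.tprod K v))) =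
      iotaC K V (g (f (v 0) (v 1)) (v 2) - g (v 0) (g (v 1) (v 2))) := by
  rw [dDown_lof_tprod]
  refine (congrArg _ (Fin.sum_univ_two _)).trans ?_
  rw [map_add, map_smul, map_smul, dif_pos (by simp), dif_pos (by simp)]
  refine (congrArg₂ (fun x y => _ • x + _ • y) (dDown_lof_one_zero_tprod f g _)
    (dDown_lof_one_zero_tprod f g _)).trans ?_
  simp only [← map_smul, ← map_add]
  simp [contractWord, sub_eq_add_neg]

theorem dDown_dDown_eq_zero_of_mem_C3
    (h₁ : ∀ a b c : V, f (f a b) c = f a (f b c))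
    (h₂ : ∀ a b c : V, f (g a b) c = g a (f b c))
    (h₃ : ∀ a b c : V, g (f a b) c = g a (g b c)) {x : TT K V} (hx : x ∈ C3 K V) :
    dDown K V f g (dDown K V f g x) = 0 := by
  suffices C3 K V ≤ LinearMap.ker (dDown K V f g ∘ₗ dDown K V f g) from this hx
  refine iSup₂_le ?_
  rintro ⟨a, b⟩ hab
  rw [LinearMap.range_le_ker_iff]
  refine PiTensorProduct.ext (MultilinearMap.ext fun v => ?_)
  simp only at hab
  obtain ⟨rfl, rfl⟩ | ⟨rfl, rfl⟩ | ⟨rfl, rfl⟩ :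
      a = 0 ∧ b = 2 ∨ a = 1 ∧ b = 1 ∨ a = 2 ∧ b = 0 := by omega
  · exact (dDown_dDown_lof_zero_two_tprod f g v).trans (by simp [h₁])
  · exact (dDown_dDown_lof_one_one_tprod f g v).trans (by simp [h₂])
  · exact (dDown_dDown_lof_two_zero_tprod f g v).trans (by simp [h₃])

theorem lof_mem_C3 (p : ℕ × ℕ) (hp : p.1 + 1 + p.2 = 3) (x : TP K V (p.1 + 1 + p.2)) :
    DirectSum.lof K (ℕ × ℕ) (fun q => TP K V (q.1 + 1 + q.2)) p x ∈ C3 K V :=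
  Submodule.mem_iSup_of_mem p (Submodule.mem_iSup_of_mem hp (LinearMap.mem_range_self _ x))

end

/-- For a vector space `A` with two bilinear operations
`ab := f a b` and `a ↘ b := g a b` and `d` the associated map on `C_*`: the three
formulas for `d ∘ d` on the pointed words of length `3`, and the equivalence between the
vanishing of `d ∘ d` on `C_3` and the three defining relations of `P_↘`-algebras. -/
theorem dd_on_C3_down :
    (∀ v₁ v₂ v₃ : V,
      dDown K V f g (dDown K V f g
          (DirectSum.lof K (ℕ × ℕ) (fun q => TP K V (q.1 + 1 + q.2)) (0, 2)
            (PiTensorProduct.tprod K ![v₁, v₂, v₃]))) =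
        iotaC K V (f (f v₁ v₂) v₃ - f v₁ (f v₂ v₃)) ∧
      dDown K V f g (dDown K V f g
          (DirectSum.lof K (ℕ × ℕ) (fun q => TP K V (q.1 + 1 + q.2)) (1, 1)
            (PiTensorProduct.tprod K ![v₁, v₂, v₃]))) =
        iotaC K V (f (g v₁ v₂) v₃ - g v₁ (f v₂ v₃)) ∧
      dDown K V f g (dDown K V f g
          (DirectSum.lof K (ℕ × ℕ) (fun q => TP K V (q.1 + 1 + q.2)) (2, 0)
            (PiTensorProduct.tprod K ![v₁, v₂, v₃]))) =
        iotaC K V (g (f v₁ v₂) v₃ - g v₁ (g v₂ v₃))) ∧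
    ((∀ x ∈ C3 K V, dDown K V f g (dDown K V f g x) = 0) ↔
      ((∀ a b c : V, f (f a b) c = f a (f b c)) ∧
       (∀ a b c : V, f (g a b) c = g a (f b c)) ∧
       (∀ a b c : V, g (f a b) c = g a (g b c)))) := by
  have key : ∀ v₁ v₂ v₃ : V, _ ∧ _ ∧ _ := fun v₁ v₂ v₃ =>
    ⟨dDown_dDown_lof_zero_two_tprod f g ![v₁, v₂, v₃],
      dDown_dDown_lof_one_one_tprod f g ![v₁, v₂, v₃],
      dDown_dDown_lof_two_zero_tprod f g ![v₁, v₂, v₃]⟩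
  refine ⟨key, fun h => ?_, fun h x hx =>
    dDown_dDown_eq_zero_of_mem_C3 f g h.1 h.2.1 h.2.2 hx⟩
  have eq_of_iotaC {x y : V} (hxy : iotaC K V (x - y) = 0) : x = y :=
    sub_eq_zero.1 (iotaC_injective (hxy.trans (map_zero _).symm))
  exact ⟨fun a b c => eq_of_iotaC ((key a b c).1.symm.trans (h _ (lof_mem_C3 (0, 2) rfl _))),
    fun a b c => eq_of_iotaC ((key a b c).2.1.symm.trans (h _ (lof_mem_C3 (1, 1) rfl _))),
    fun a b c => eq_of_iotaC ((key a b c).2.2.symm.trans (h _ (lof_mem_C3 (2, 0) rfl _)))⟩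
end
end

section
/- Let A be a K-vector space with two bilinear operations (a,b) ↦ ab and (a,b) ↦ a ↗ b satisfying the three relations (ab)c = a(bc), (a↗b)c = a↗(bc) and (a↗b)↗c = a↗(b↗c) for all a, b, c ∈ A. Then the map d on C_* defined from these operations satisfies d∘d = 0, i.e. d(d(x)) = 0 for every x ∈ C_n and every n ≥ 1; thus (C_*, d) is a chain complex. -/
open scoped TensorProduct DirectSum

noncomputable section

variable (K : Type*) [Field K] (V : Type*) [AddCommGroup V] [Module K V]

variable (f g : V →ₗ[K] V →ₗ[K] V)

/-- The component on the summand of index `(a, b)` (word of length `n = a+1+b` whose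
first `a` tensor signs are marked) of the differential of the complex computing the
homology of an algebra `(V, f, g)` with products `ab := f a b` and `a ↗ b := g a b`: the
alternating sum over the `n-1` pairs of adjacent letters of the contractions, the pairs
joined by a marked tensor sign (0-indexed merge positions `p < a`) being contracted by
`↗` and the other ones by `f`; the number of marked signs decreases by one in the first
case and is unchanged in the second. -/
def dCompUp (a b : ℕ) : TP K V (a + 1 + b) →ₗ[K] TT K V :=
  ∑ p : Fin (a + 1 + b - 1),
    ((-1 : K) ^ (p : ℕ)) •
      (if hpa : (p : ℕ) < a then
        (DirectSum.lof K (ℕ × ℕ) (fun q => TP K V (q.1 + 1 + q.2)) (a - 1, b)) ∘ₗ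
          (castE K V (show a + 1 + b - 1 = (a - 1) + 1 + b by
            have := p.isLt; omega)).toLinearMap ∘ₗ
          mergeAt K V g (a + 1 + b) p (by have := p.isLt; omega)
      else
        (DirectSum.lof K (ℕ × ℕ) (fun q => TP K V (q.1 + 1 + q.2)) (a, b - 1)) ∘ₗ
          (castE K V (show a + 1 + b - 1 = a + 1 + (b - 1) by
            have := p.isLt; omega)).toLinearMap ∘ₗ
          mergeAt K V f (a + 1 + b) p (by have := p.isLt; omega))

/-- The differential `d` of the complex `C_*` associated with the algebra `(V, f, g)`
with products `ab := f a b` and `a ↗ b := g a b`. -/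
def dUp : TT K V →ₗ[K] TT K V :=
  DirectSum.toModule K (ℕ × ℕ) (TT K V) fun q => dCompUp K V f g q.1 q.2
/-- The pure tensor in `V^{⊗n}` on the first `n` letters of an infinite word. -/
def wordTensor (n : ℕ) (w : ℕ → V) : TP K V n :=
  PiTensorProduct.tprod K fun i : Fin n => w i

variable {K V}

theorem wordTensor_congr (n : ℕ) {w w' : ℕ → V} (h : ∀ i < n, w i = w' i) :
    wordTensor K V n w = wordTensor K V n w' := by
  unfold wordTensor
  congr 1
  funext i
  exact h i i.isLt

theorem castE_wordTensor {a b : ℕ} (h : a = b) (w : ℕ → V) :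
    castE K V h (wordTensor K V a w) = wordTensor K V b w := by
  subst h
  simp [castE, wordTensor]

theorem mulE_wordTensor (a b : ℕ) (u v : ℕ → V) :
    mulE K V a b (wordTensor K V a u ⊗ₜ[K] wordTensor K V b v) =
      wordTensor K V (a + b) fun i => if i < a then u i else v (i - a) := by
  simp only [mulE, wordTensor, LinearEquiv.trans_apply, PiTensorProduct.tmulEquiv_apply,
    PiTensorProduct.reindex_tprod]
  congr 1
  funext i
  refine Fin.addCases (fun j => ?_) (fun j => ?_) i <;> simp

theorem mulE_symm_wordTensor (a b : ℕ) (w : ℕ → V) :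
    (mulE K V a b).symm (wordTensor K V (a + b) w) =
      wordTensor K V a w ⊗ₜ[K] wordTensor K V b fun i => w (a + i) := by
  rw [LinearEquiv.symm_apply_eq, mulE_wordTensor]
  refine wordTensor_congr _ fun i _ => ?_
  split_ifs
  · rfl
  · congr 1
    omega

theorem oneE_wordTensor (w : ℕ → V) : oneE K V (wordTensor K V 1 w) = w 0 := by
  simp [oneE, wordTensor]

theorem oneE_symm_apply (x : V) : (oneE K V).symm x = wordTensor K V 1 fun _ => x := by
  rw [LinearEquiv.symm_apply_eq, oneE_wordTensor]

/-- The word obtained by replacing the letters at (0-indexed) positions `p`, `p + 1` by their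
product. -/
def mergeWord (m : V →ₗ[K] V →ₗ[K] V) (p : ℕ) (w : ℕ → V) : ℕ → V := fun i =>
  if i < p then w i else if i = p then m (w p) (w (p + 1)) else w (i + 1)

variable {f g}

theorem f2_wordTensor (w : ℕ → V) : f2 K V f (wordTensor K V 2 w) = f (w 0) (w 1) := by
  simp only [f2, LinearMap.comp_apply, LinearEquiv.coe_coe, castE_wordTensor]
  rw [mulE_symm_wordTensor, TensorProduct.map_tmul, TensorProduct.lift.tmul]
  simp only [LinearEquiv.coe_coe, oneE_wordTensor, add_zero]

theorem mergeAt_wordTensor (n p : ℕ) (h : p + 2 ≤ n) (w : ℕ → V) :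
    mergeAt K V f n p h (wordTensor K V n w) = wordTensor K V (n - 1) (mergeWord f p w) := by
  simp only [mergeAt, mergeCore, LinearMap.comp_apply, LinearEquiv.coe_coe, castE_wordTensor,
    mulE_symm_wordTensor, TensorProduct.map_tmul, LinearMap.id_apply, f2_wordTensor,
    oneE_symm_apply, mulE_wordTensor]
  refine wordTensor_congr _ fun i _ => ?_
  rcases lt_trichotomy i p with hi | rfl | hi
  · simp [mergeWord, hi]
  · simp [mergeWord]
  · have h₁ : ¬ i < p := by omega
    have h₂ : ¬ i - p < 1 := by omega
    have h₃ : i ≠ p := by omega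
    simp only [mergeWord, h₁, h₂, h₃, if_false]
    congr 1
    omega

theorem mergeWord_mergeWord_of_lt (m m' : V →ₗ[K] V →ₗ[K] V) {p q : ℕ} (h : p < q)
    (w : ℕ → V) :
    mergeWord m' q (mergeWord m p w) = mergeWord m p (mergeWord m' (q + 1) w) := by
  funext i
  simp only [mergeWord]
  grind

theorem mergeWord_mergeWord_self (m m' k k' : V →ₗ[K] V →ₗ[K] V)
    (h : ∀ a b c, m' (m a b) c = k' a (k b c)) (p : ℕ) (w : ℕ → V) :
    mergeWord m' p (mergeWord m p w) = mergeWord k' p (mergeWord k (p + 1) w) := by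
  funext i
  simp only [mergeWord]
  grind

variable (K V) in
/-- The pure tensor on a word in the summand of `TT K V` of index `q`. -/
def pureTT (q : ℕ × ℕ) (w : ℕ → V) : TT K V :=
  DirectSum.lof K (ℕ × ℕ) (fun q => TP K V (q.1 + 1 + q.2)) q
    (wordTensor K V (q.1 + 1 + q.2) w)

/-- The index of the summand containing the contraction at position `p` of the summand of
index `q`. -/
def contractIndex (p : ℕ) (q : ℕ × ℕ) : ℕ × ℕ :=
  if p < q.1 then (q.1 - 1, q.2) else (q.1, q.2 - 1)

variable (f g) in
/-- The operation contracting the letters at positions `p`, `p + 1` in the summand of index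
`q`. -/
def contractOp (p : ℕ) (q : ℕ × ℕ) : V →ₗ[K] V →ₗ[K] V :=
  if p < q.1 then g else f

theorem contractIndex_sum {p : ℕ} {q : ℕ × ℕ} (h : p < q.1 + q.2) :
    (contractIndex p q).1 + (contractIndex p q).2 = q.1 + q.2 - 1 := by
  unfold contractIndex
  split_ifs <;> simp only <;> omega

theorem dUp_pureTT (q : ℕ × ℕ) (w : ℕ → V) :
    dUp K V f g (pureTT K V q w) = ∑ p ∈ Finset.range (q.1 + q.2),
      (-1 : K) ^ p • pureTT K V (contractIndex p q) (mergeWord (contractOp f g p q) p w) := by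
  obtain ⟨a, b⟩ := q
  have hab : a + b = a + 1 + b - 1 := by omega
  rw [dUp, pureTT, DirectSum.toModule_lof, dCompUp, LinearMap.sum_apply, hab, ← Fin.sum_univ_eq_sum_range (fun p => (-1 : K) ^ p • pureTT K V (contractIndex p (a, b))
    (mergeWord (contractOp f g p (a, b)) p w))]
  refine Finset.sum_congr rfl fun p _ => ?_
  rw [LinearMap.smul_apply]
  congr 1
  by_cases h : (p : ℕ) < a
  · have hc : contractIndex p (a, b) = (a - 1, b) := by simp [contractIndex, h]
    have ho : contractOp f g p (a, b) = g := by simp [contractOp, h]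
    rw [hc, ho]
    simp only [h, dite_true, LinearMap.comp_apply, LinearEquiv.coe_coe, mergeAt_wordTensor,
      castE_wordTensor, pureTT]
  · have hc : contractIndex p (a, b) = (a, b - 1) := by simp [contractIndex, h]
    have ho : contractOp f g p (a, b) = f := by simp [contractOp, h]
    rw [hc, ho]
    simp only [h, dite_false, LinearMap.comp_apply, LinearEquiv.coe_coe, mergeAt_wordTensor,
      castE_wordTensor, pureTT]

theorem linearMap_ext_pureTT {M : Type*} [AddCommGroup M] [Module K M] {φ ψ : TT K V →ₗ[K] M}
    (h : ∀ q w, φ (pureTT K V q w) = ψ (pureTT K V q w)) : φ = ψ := by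
  refine DirectSum.linearMap_ext K fun q => PiTensorProduct.ext (MultilinearMap.ext fun v => ?_)
  have hv : PiTensorProduct.tprod K v = wordTensor K V (q.1 + 1 + q.2)
      fun i => if hi : i < q.1 + 1 + q.2 then v ⟨i, hi⟩ else 0 := by
    simp [wordTensor]
  simpa only [LinearMap.compMultilinearMap_apply, LinearMap.comp_apply, hv, pureTT] using h q _

theorem sum_range_alternating_eq_zero {M : Type*} [AddCommGroup M] [Module K M] (n : ℕ)
    (F : ℕ → ℕ → M) (hF : ∀ p q, p ≤ q → q + 1 < n → F p q = F (q + 1) p) :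
    ∑ p ∈ Finset.range n, ∑ q ∈ Finset.range (n - 1), (-1 : K) ^ (p + q) • F p q = 0 := by
  rw [← Finset.sum_product' (Finset.range n) (Finset.range (n - 1))
    fun p q => (-1 : K) ^ (p + q) • F p q]
  refine Finset.sum_involution
    (fun x _ => if x.1 ≤ x.2 then (x.2 + 1, x.1) else (x.2, x.1 - 1)) ?_ ?_ ?_ ?_
  · rintro ⟨p, q⟩ hx
    simp only [Finset.mem_product, Finset.mem_range] at hx
    by_cases h : p ≤ q
    · simp only [h, if_true]
      rw [← hF p q h (by omega), ← add_smul,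
        show q + 1 + p = p + q + 1 by omega, pow_succ]
      simp
    · obtain ⟨r, rfl⟩ : ∃ r, p = r + 1 := ⟨p - 1, by omega⟩
      simp only [h, if_false, Nat.add_sub_cancel]
      rw [hF q r (by omega) (by omega), ← add_smul,
        show r + 1 + q = q + r + 1 by omega, pow_succ]
      simp
  · rintro ⟨p, q⟩ hx _
    grind
  · rintro ⟨p, q⟩ hx
    simp only [Finset.mem_product, Finset.mem_range] at hx ⊢
    split_ifs <;> simp only <;> omega
  · rintro ⟨p, q⟩ hx
    grind

variable (K V f g)

/-- If the two bilinear operations `ab := f a b` and `a ↗ b := g a b` on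
the vector space `A` satisfy the three defining relations of `P_↗`-algebras, then the
associated map `d` on `C_*` satisfies `d ∘ d = 0`: `(C_*, d)` is a chain complex. -/
theorem dd_eq_zero_up
    (h₁ : ∀ a b c : V, f (f a b) c = f a (f b c))
    (h₂ : ∀ a b c : V, f (g a b) c = g a (f b c))
    (h₃ : ∀ a b c : V, g (g a b) c = g a (g b c)) :
    ∀ x : TT K V, dUp K V f g (dUp K V f g x) = 0 := by
  suffices h : dUp K V f g ∘ₗ dUp K V f g = 0 from fun x => LinearMap.congr_fun h x
  refine linearMap_ext_pureTT fun q w => ?_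
  rw [LinearMap.comp_apply, dUp_pureTT, map_sum, LinearMap.zero_apply,
    ← sum_range_alternating_eq_zero (K := K) (q.1 + q.2) (fun p r =>
      pureTT K V (contractIndex r (contractIndex p q))
        (mergeWord (contractOp f g r (contractIndex p q)) r
          (mergeWord (contractOp f g p q) p w)))]
  · refine Finset.sum_congr rfl fun p hp => ?_
    rw [map_smul, dUp_pureTT, contractIndex_sum (Finset.mem_range.mp hp), Finset.smul_sum]
    exact Finset.sum_congr rfl fun r _ => by rw [smul_smul, pow_add]
  · intro p r hpr hr
    obtain ⟨a, b⟩ := q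
    have hi : contractIndex r (contractIndex p (a, b)) =
        contractIndex p (contractIndex (r + 1) (a, b)) := by
      simp only [contractIndex]
      grind
    rw [hi]
    congr 1
    rcases hpr.lt_or_eq with hlt | rfl
    · have h₄ : contractOp f g r (contractIndex p (a, b)) = contractOp f g (r + 1) (a, b) := by
        simp only [contractOp, contractIndex]
        grind
      have h₅ : contractOp f g p (contractIndex (r + 1) (a, b)) = contractOp f g p (a, b) := by
        simp only [contractOp, contractIndex]
        grind
      rw [h₄, h₅, mergeWord_mergeWord_of_lt _ _ hlt]
    · refine mergeWord_mergeWord_self _ _ _ _ (fun x y z => ?_) p w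
      simp only [contractOp, contractIndex]
      grind
end
end
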